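/- Let M be an affine semigroup with atoms m_1, …, m_e, fix i ∈ {1, …, e}, and let M_i = φ(Minimals_≤ Z(m_i + M)), where Z(m_i + M) = ∪_{m ∈ m_i + M} Z(m) and Minimals_≤ denotes the set of minimal elements with respect to the usual componentwise partial order on ℕ^e. Then M_i is finite and the tame degree of M with respect to m_i satisfies t(M, m_i) = max{ t(m, m_i) : m ∈ M_i }. -/

import Mathlib

/-- The factorization homomorphism `φ : ℕ^e → ℕ^k`, `φ(x) = ∑ xᵢ • mᵢ`. -/
def factorizationHom {k e : ℕ} (m : Fin e → (Fin k → ℕ)) : (Fin e → ℕ) →+ (Fin k → ℕ) where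
  toFun x := ∑ i, x i • m i
  map_zero' := by simp
  map_add' x y := by
    simp [add_smul, Finset.sum_add_distrib]

/-- The set of factorizations `Z(n) = φ⁻¹(n)`. -/
def factsOf {k e : ℕ} (m : Fin e → (Fin k → ℕ)) (n : Fin k → ℕ) : Set (Fin e → ℕ) :=
  {x | factorizationHom m x = n}

/-- `a` is an atom (irreducible element) of `M`. -/
def IsAtomOf {k : ℕ} (M : AddSubmonoid (Fin k → ℕ)) (a : Fin k → ℕ) : Prop :=
  a ∈ M ∧ a ≠ 0 ∧ ∀ x y, x ∈ M → y ∈ M → a = x + y → x = 0 ∨ y = 0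

/-- The distance between two factorizations:
`d(x,y) = max{|x − x∧y|, |y − x∧y|}` where `x∧y` is the componentwise minimum. -/
def factDist {e : ℕ} (x y : Fin e → ℕ) : ℕ :=
  max (∑ i, (x i - min (x i) (y i))) (∑ i, (y i - min (x i) (y i)))

/-- The tame degree `t(n, m_i)` of `n` with respect to the `i`-th atom: the least
`t` such that every factorization `z` of `n` is at distance at most `t` from a
factorization `z'` of `n` whose `i`-th coordinate is nonzero. -/
noncomputable def tameDeg {k e : ℕ} (m : Fin e → (Fin k → ℕ)) (n : Fin k → ℕ)
    (i : Fin e) : ℕ :=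
  sInf {t | ∀ z ∈ factsOf m n, ∃ z' ∈ factsOf m n, z' i ≠ 0 ∧ factDist z z' ≤ t}

/-- The set `Z(m_i + M)` of factorizations of elements of the principal ideal
`m_i + M`. -/
def factsOfIdeal {k e : ℕ} (m : Fin e → (Fin k → ℕ)) (M : AddSubmonoid (Fin k → ℕ))
    (i : Fin e) : Set (Fin e → ℕ) :=
  {x | ∃ n, (∃ u ∈ M, n = m i + u) ∧ x ∈ factsOf m n}

/-- `Minimals_≤ Z(m_i + M)`: the minimal elements, for the componentwise order on
`ℕ^e`, of the set of factorizations of elements of `m_i + M`. -/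
def minimalFactsOfIdeal {k e : ℕ} (m : Fin e → (Fin k → ℕ))
    (M : AddSubmonoid (Fin k → ℕ)) (i : Fin e) : Set (Fin e → ℕ) :=
  {x | x ∈ factsOfIdeal m M i ∧ ∀ y ∈ factsOfIdeal m M i, y ≤ x → y = x}

theorem factorizationHom_apply {k e : ℕ} (m : Fin e → (Fin k → ℕ)) (x : Fin e → ℕ) :
    factorizationHom m x = ∑ i, x i • m i := rfl

theorem factorizationHom_single_one {k e : ℕ} (m : Fin e → (Fin k → ℕ)) (i : Fin e) :
    factorizationHom m (Pi.single i 1) = m i := by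
  simp [factorizationHom_apply, Pi.single_apply, ite_smul]

theorem mrange_factorizationHom {k e : ℕ} (m : Fin e → (Fin k → ℕ)) :
    AddMonoidHom.mrange (factorizationHom m) = AddSubmonoid.closure (Set.range m) := by
  apply le_antisymm
  · rintro _ ⟨x, rfl⟩
    rw [factorizationHom_apply]
    exact sum_mem fun i _ => nsmul_mem (AddSubmonoid.subset_closure (Set.mem_range_self i)) _
  · rw [AddSubmonoid.closure_le]
    rintro _ ⟨i, rfl⟩
    exact ⟨Pi.single i 1, factorizationHom_single_one m i⟩

theorem factDist_le_sum_add_sum {e : ℕ} (x y : Fin e → ℕ) :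
    factDist x y ≤ ∑ i, x i + ∑ i, y i := by
  have hx : ∑ i, (x i - min (x i) (y i)) ≤ ∑ i, x i :=
    Finset.sum_le_sum fun i _ => Nat.sub_le _ _
  have hy : ∑ i, (y i - min (x i) (y i)) ≤ ∑ i, y i :=
    Finset.sum_le_sum fun i _ => Nat.sub_le _ _
  exact max_le (by omega) (by omega)

theorem factDist_add_left {e : ℕ} (w x y : Fin e → ℕ) :
    factDist (w + x) (w + y) = factDist x y := by
  simp only [factDist, Pi.add_apply, min_add_add_left, Nat.add_sub_add_left]

theorem sum_le_sum_factorizationHom {k e : ℕ} {m : Fin e → (Fin k → ℕ)} (hm : ∀ i, m i ≠ 0)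
    (x : Fin e → ℕ) : ∑ i, x i ≤ ∑ j, factorizationHom m x j := by
  simp only [factorizationHom_apply, Finset.sum_apply, Pi.smul_apply, smul_eq_mul]
  rw [Finset.sum_comm]
  refine Finset.sum_le_sum fun i _ => ?_
  obtain ⟨j, hj⟩ := Function.ne_iff.mp (hm i)
  calc x i ≤ x i * m i j := Nat.le_mul_of_pos_right _ (Nat.pos_of_ne_zero hj)
    _ ≤ ∑ j, x i * m i j :=
      Finset.single_le_sum (f := fun j => x i * m i j) (fun _ _ => Nat.zero_le _)
        (Finset.mem_univ j)

/-- The infimum defining the tame degree is attained on `m i + M`. -/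
theorem exists_factDist_le_tameDeg {k e : ℕ} {m : Fin e → (Fin k → ℕ)} (hm : ∀ i, m i ≠ 0)
    {u : Fin k → ℕ} (hu : u ∈ AddSubmonoid.closure (Set.range m)) (i : Fin e)
    {z : Fin e → ℕ} (hz : z ∈ factsOf m (m i + u)) :
    ∃ z' ∈ factsOf m (m i + u), z' i ≠ 0 ∧ factDist z z' ≤ tameDeg m (m i + u) i := by
  rw [← mrange_factorizationHom] at hu
  obtain ⟨y, rfl⟩ := hu
  refine Nat.sInf_mem (s := {t | ∀ z ∈ factsOf m (m i + factorizationHom m y),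
    ∃ z' ∈ factsOf m (m i + factorizationHom m y), z' i ≠ 0 ∧ factDist z z' ≤ t}) ?_ z hz
  refine ⟨∑ j, (m i + factorizationHom m y) j + ∑ j, (Pi.single i 1 + y : Fin e → ℕ) j, fun x hx =>
    ⟨Pi.single i 1 + y, ?_, by simp, ?_⟩⟩
  · change factorizationHom m _ = _
    rw [map_add, factorizationHom_single_one]
  · have h := sum_le_sum_factorizationHom hm x
    rw [show factorizationHom m x = _ from hx] at h
    exact (factDist_le_sum_add_sum _ _).trans (Nat.add_le_add_right h _)

theorem finite_minimalFactsOfIdeal {k e : ℕ} (m : Fin e → (Fin k → ℕ))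
    (M : AddSubmonoid (Fin k → ℕ)) (i : Fin e) : (minimalFactsOfIdeal m M i).Finite :=
  WellQuasiOrderedLE.finite_of_isAntichain fun _ hx _ hy hne hle => hne (hy.2 _ hx.1 hle)

theorem exists_minimalFactsOfIdeal_le {k e : ℕ} {m : Fin e → (Fin k → ℕ)}
    {M : AddSubmonoid (Fin k → ℕ)} {i : Fin e} {z : Fin e → ℕ} (hz : z ∈ factsOfIdeal m M i) :
    ∃ x ∈ minimalFactsOfIdeal m M i, x ≤ z := by
  obtain ⟨x, hxz, hx⟩ := exists_minimal_le_of_wellFoundedLT (· ∈ factsOfIdeal m M i) z hz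
  exact ⟨x, ⟨hx.prop, fun y hy hyx => le_antisymm hyx (hx.le_of_le hy hyx)⟩, hxz⟩

/-- Let `M` be an affine semigroup with atoms `m_1, …, m_e` and let
`M_i = φ(Minimals_≤ Z(m_i + M))`.  Then `M_i` is finite and the tame degree of `M`
with respect to `m_i`, that is `t(M, m_i) = sup{t(n, m_i) : n ∈ m_i + M}`, equals
`max{t(n, m_i) : n ∈ M_i}`. -/
theorem tame_degree_via_minimal_factorizations (k e : ℕ) (m : Fin e → (Fin k → ℕ))
    (M : AddSubmonoid (Fin k → ℕ))
    (hgen : AddSubmonoid.closure (Set.range m) = M)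
    (hinj : Function.Injective m)
    (hatoms : ∀ i, IsAtomOf M (m i)) (i : Fin e) :
    (factorizationHom m '' minimalFactsOfIdeal m M i).Finite ∧
      IsGreatest
        {t : ℕ | ∃ n ∈ factorizationHom m '' minimalFactsOfIdeal m M i, t = tameDeg m n i}
        (sSup {t : ℕ | ∃ n, (∃ u ∈ M, n = m i + u) ∧ t = tameDeg m n i}) := by
  have hfin : (factorizationHom m '' minimalFactsOfIdeal m M i).Finite :=
    (finite_minimalFactsOfIdeal m M i).image _
  refine ⟨hfin, ?_⟩
  have hm : ∀ j, m j ≠ 0 := fun j => (hatoms j).2.1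
  subst hgen
  obtain ⟨x₀, hx₀, -⟩ := exists_minimalFactsOfIdeal_le
    (show Pi.single i 1 ∈ factsOfIdeal m (AddSubmonoid.closure (Set.range m)) i from
      ⟨m i, ⟨0, zero_mem _, (add_zero _).symm⟩, factorizationHom_single_one m i⟩)
  obtain ⟨n, hn, hmax⟩ := Set.exists_max_image _ (fun n => tameDeg m n i) hfin
    ⟨_, Set.mem_image_of_mem _ hx₀⟩
  have hn_ideal : ∃ u ∈ AddSubmonoid.closure (Set.range m), n = m i + u := by
    obtain ⟨x, ⟨⟨_, hu, rfl⟩, -⟩, rfl⟩ := hn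
    exact hu
  have hsup : IsGreatest {t : ℕ | ∃ n, (∃ u ∈ AddSubmonoid.closure (Set.range m), n = m i + u) ∧
      t = tameDeg m n i} (tameDeg m n i) := by
    refine ⟨⟨n, hn_ideal, rfl⟩, ?_⟩
    rintro _ ⟨p, hp, rfl⟩
    refine Nat.sInf_le fun z hz => ?_
    obtain ⟨x, hx, hxz⟩ := exists_minimalFactsOfIdeal_le ⟨p, hp, hz⟩
    obtain ⟨q, ⟨u, hu, rfl⟩, hxq⟩ := hx.1
    obtain ⟨x', hx', hx'i, hdist⟩ := exists_factDist_le_tameDeg hm hu i hxq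
    have hz_eq : z - x + x = z := tsub_add_cancel_of_le hxz
    refine ⟨z - x + x', ?_, by simp [hx'i], ?_⟩
    · change factorizationHom m _ = p
      rw [map_add, show factorizationHom m x' = _ from hx',
        ← show factorizationHom m x = _ from hxq, ← map_add, hz_eq]
      exact hz
    · calc factDist z (z - x + x') = factDist (z - x + x) (z - x + x') := by rw [hz_eq]
        _ = factDist x x' := factDist_add_left _ _ _
        _ ≤ _ := hdist
        _ ≤ tameDeg m n i := hmax _ ⟨x, hx, hxq⟩
  rw [hsup.csSup_eq]
  refine ⟨⟨n, hn, rfl⟩, ?_⟩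
  rintro _ ⟨p, hp, rfl⟩
  exact hmax p hp
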